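/- The vector (φ,φ) belongs to Λ, and for every (a,b) ∈ Ω₁ the vector g_{a,b}·(φ,φ) = (φ(a+b), φ/a) satisfies 0 < φ(a+b) ≤ 1, has positive second coordinate, and has slope 1/(a(a+b)); moreover, for every v ∈ Λ such that g_{a,b}·v = (x,y) satisfies 0 < x ≤ 1 and y > 0, one has y/x ≥ 1/(a(a+b)). That is, g_{a,b}·(φ,φ) is the vector of smallest slope in g_{a,b}Λ ∩ ((0,1]×(0,∞)). -/

import Mathlib

open Matrix MeasureTheory Filter Topology

noncomputable section

abbrev SL2 := Matrix.SpecialLinearGroup (Fin 2) ℝ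

/-- The golden ratio φ = (1+√5)/2. -/
def phi : ℝ := (1 + Real.sqrt 5) / 2

/-- φ̄ = 1/φ. -/
def phib : ℝ := phi⁻¹

/-- S = [[0,−1],[1,0]]. -/
def Smat : SL2 := ⟨!![0, -1; 1, 0], by norm_num [Matrix.det_fin_two_of]⟩

/-- P = [[1,φ],[0,1]]. -/
def Pmat : SL2 := ⟨!![1, phi; 0, 1], by norm_num [Matrix.det_fin_two_of]⟩

/-- The Veech group of the golden L: the subgroup generated by S and P. -/
def Γ : Subgroup SL2 := Subgroup.closure {Smat, Pmat}

/-- Linear action of a 2×2 matrix on ℝ². -/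
def mact (g : Matrix (Fin 2) (Fin 2) ℝ) (v : ℝ × ℝ) : ℝ × ℝ :=
  (g 0 0 * v.1 + g 0 1 * v.2, g 1 0 * v.1 + g 1 1 * v.2)

/-- Λ = Γ·(1,0)ᵀ. -/
def Λ : Set (ℝ × ℝ) := {v | ∃ γ ∈ Γ, v = mact (γ : Matrix (Fin 2) (Fin 2) ℝ) (1, 0)}

/-- g_{a,b} = [[a,b],[0,1/a]]. -/
def gab (a b : ℝ) : Matrix (Fin 2) (Fin 2) ℝ := !![a, b; 0, a⁻¹]

/-- h_s = [[1,0],[−s,1]]. -/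
def hmat (s : ℝ) : Matrix (Fin 2) (Fin 2) ℝ := !![1, 0; -s, 1]

/-- Ω = {(a,b) : 0 < a ≤ 1, 1 − aφ < b ≤ 1}. -/
def Ω : Set (ℝ × ℝ) := {p | 0 < p.1 ∧ p.1 ≤ 1 ∧ 1 - p.1 * phi < p.2 ∧ p.2 ≤ 1}

/-- Ω₁ = {(a,b) ∈ Ω : φ̄ ≤ a ≤ 1, 1 − aφ < b ≤ φ̄ − a}. -/
def Ω₁ : Set (ℝ × ℝ) :=
  {p | p ∈ Ω ∧ phib ≤ p.1 ∧ p.1 ≤ 1 ∧ 1 - p.1 * phi < p.2 ∧ p.2 ≤ phib - p.1}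

/-- Ω_φ = {(a,b) ∈ Ω : φ̄² ≤ a ≤ 1, φ̄ − a < b ≤ φ̄ − aφ̄}. -/
def Ωphi : Set (ℝ × ℝ) :=
  {p | p ∈ Ω ∧ phib ^ 2 ≤ p.1 ∧ p.1 ≤ 1 ∧ phib - p.1 < p.2 ∧ p.2 ≤ phib - p.1 * phib}

/-- Ω_∞ = {(a,b) ∈ Ω : φ̄ − aφ̄ < b ≤ 1}. -/
def Ωinf : Set (ℝ × ℝ) := {p | p ∈ Ω ∧ phib - p.1 * phib < p.2 ∧ p.2 ≤ 1}

-- The return time function R.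
open Classical in
noncomputable def Rfun (p : ℝ × ℝ) : ℝ :=
  if p ∈ Ω₁ then 1 / (p.1 * (p.1 + p.2))
  else if p ∈ Ωphi then 1 / (p.1 * (p.1 * phib + p.2))
  else 1 / (p.1 * p.2)

/-- The probability measure m with dm = (2/φ) da db on Ω. -/
noncomputable def m : Measure (ℝ × ℝ) := ENNReal.ofReal (2 / phi) • volume.restrict Ω

-- The golden-L BCZ map T.
open Classical in
noncomputable def Tmap (p : ℝ × ℝ) : ℝ × ℝ :=
  if p ∈ Ω₁ then
    ((p.1 + p.2) * phi,
      p.1 + p.2 * phi +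
        (-(⌊(p.1 + p.2 * phi - 1) / (phi ^ 2 * (p.1 + p.2))⌋ : ℤ) : ℝ) * phi ^ 2 * (p.1 + p.2))
  else if p ∈ Ωphi then
    (p.1 + p.2 * phi,
      p.2 + (-(⌊(p.2 - 1) / (phi * (p.1 + p.2 * phi))⌋ : ℤ) : ℝ) * phi * (p.1 + p.2 * phi))
  else
    (p.2, -p.1 + (-(⌊(-p.1 - 1) / (phi * p.2)⌋ : ℤ) : ℝ) * phi * p.2)

theorem phi_sq : phi ^ 2 = phi + 1 := by
  unfold phi
  nlinarith [Real.sq_sqrt (show (0 : ℝ) ≤ 5 by norm_num)]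

theorem one_lt_phi : 1 < phi := by
  unfold phi
  have : (1 : ℝ) < Real.sqrt 5 := by
    rw [Real.lt_sqrt] <;> norm_num
  linarith

theorem phib_eq : phib = phi - 1 := by
  have h := one_lt_phi
  unfold phib
  rw [inv_eq_iff_eq_inv, eq_comm, inv_eq_iff_eq_inv, eq_comm]
  exact inv_eq_of_mul_eq_one_right (by nlinarith [phi_sq])

/-- The vectors obtained from the two standard basis vectors by the Farey-type substitutions whose
columns are consecutive vectors among `(1,0)`, `(φ,1)`, `(φ,φ)`, `(1,φ)`, `(0,1)`. -/
inductive FareyVec : ℝ → ℝ → Prop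
  | e₁ : FareyVec 1 0
  | e₂ : FareyVec 0 1
  | sector₀ {x y : ℝ} : FareyVec x y → FareyVec (x + phi * y) y
  | sector₁ {x y : ℝ} : FareyVec x y → FareyVec (phi * x + phi * y) (x + phi * y)
  | sector₂ {x y : ℝ} : FareyVec x y → FareyVec (phi * x + y) (phi * x + phi * y)
  | sector₃ {x y : ℝ} : FareyVec x y → FareyVec x (phi * x + y)

theorem eq_zero_or_one_le_add {x y : ℝ} (hx : x = 0 ∨ 1 ≤ x) (hy : y = 0 ∨ 1 ≤ y) :
    x + y = 0 ∨ 1 ≤ x + y := by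
  rcases hx with rfl | hx <;> rcases hy with rfl | hy
  · simp
  · right; linarith
  · right; linarith
  · right; linarith

theorem eq_zero_or_one_le_phi_mul {x : ℝ} (hx : x = 0 ∨ 1 ≤ x) :
    phi * x = 0 ∨ 1 ≤ phi * x := by
  rcases hx with rfl | hx
  · simp
  · right; nlinarith [one_lt_phi]

theorem FareyVec.eq_zero_or_one_le {x y : ℝ} (h : FareyVec x y) :
    (x = 0 ∨ 1 ≤ x) ∧ (y = 0 ∨ 1 ≤ y) := by
  induction h with
  | e₁ => simp
  | e₂ => simp
  | sector₀ _ ih =>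
    exact ⟨eq_zero_or_one_le_add ih.1 (eq_zero_or_one_le_phi_mul ih.2), ih.2⟩
  | sector₁ _ ih =>
    exact ⟨eq_zero_or_one_le_add (eq_zero_or_one_le_phi_mul ih.1) (eq_zero_or_one_le_phi_mul ih.2),
      eq_zero_or_one_le_add ih.1 (eq_zero_or_one_le_phi_mul ih.2)⟩
  | sector₂ _ ih =>
    exact ⟨eq_zero_or_one_le_add (eq_zero_or_one_le_phi_mul ih.1) ih.2,
      eq_zero_or_one_le_add (eq_zero_or_one_le_phi_mul ih.1) (eq_zero_or_one_le_phi_mul ih.2)⟩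
  | sector₃ _ ih =>
    exact ⟨ih.1, eq_zero_or_one_le_add (eq_zero_or_one_le_phi_mul ih.1) ih.2⟩

theorem FareyVec.nonneg {x y : ℝ} (h : FareyVec x y) : 0 ≤ x ∧ 0 ≤ y := by
  obtain ⟨hx | hx, hy | hy⟩ := h.eq_zero_or_one_le <;> constructor <;> linarith

/-- The union of the four quarter-turn images of `FareyVec`. -/
def FareyOrbit (x y : ℝ) : Prop :=
  FareyVec x y ∨ FareyVec (-x) (-y) ∨ FareyVec y (-x) ∨ FareyVec (-y) x

theorem FareyOrbit.rotate {x y : ℝ} (h : FareyOrbit x y) : FareyOrbit (-y) x := by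
  unfold FareyOrbit at *
  rw [neg_neg]
  tauto

theorem FareyOrbit.neg {x y : ℝ} (h : FareyOrbit x y) : FareyOrbit (-x) (-y) :=
  h.rotate.rotate

theorem FareyOrbit.congr {x y x' y' : ℝ} (h : FareyOrbit x y) (hx : x = x') (hy : y = y') :
    FareyOrbit x' y' := hx ▸ hy ▸ h

theorem FareyVec.congr {x y x' y' : ℝ} (h : FareyVec x y) (hx : x = x') (hy : y = y') :
    FareyVec x' y' := hx ▸ hy ▸ h

theorem FareyVec.orbit_shear_rotate {x y : ℝ} (h : FareyVec x y) :
    FareyOrbit (-y + phi * x) x := by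
  have hp := phi_sq
  cases h with
  | e₁ => exact Or.inl (FareyVec.e₂.sector₀.congr (by ring) rfl)
  | e₂ => exact Or.inr (Or.inl (FareyVec.e₁.congr (by ring) (by ring)))
  | @sector₀ x y h =>
    exact Or.inl (h.sector₁.congr (by linear_combination -y * hp) rfl)
  | @sector₁ x y h =>
    exact Or.inl (h.sector₂.congr (by linear_combination -(x + y) * hp) rfl)
  | @sector₂ x y h =>
    exact Or.inl (h.sector₃.congr (by linear_combination -x * hp) rfl)
  | sector₃ h => exact Or.inr (Or.inr (Or.inl (h.congr rfl (by ring))))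

theorem FareyVec.orbit_shear_inv {x y : ℝ} (h : FareyVec x y) :
    FareyOrbit (x - phi * y) y := by
  have hp := phi_sq
  cases h with
  | e₁ => exact Or.inl (FareyVec.e₁.congr (by ring) rfl)
  | e₂ => exact Or.inr (Or.inr (Or.inl (FareyVec.e₁.sector₃.congr rfl (by ring))))
  | sector₀ h => exact Or.inl (h.congr (by ring) rfl)
  | @sector₁ x y h =>
    exact Or.inr (Or.inr (Or.inl (h.sector₀.congr rfl (by linear_combination -y * hp))))
  | @sector₂ x y h =>
    exact Or.inr (Or.inr (Or.inl (h.sector₁.congr rfl (by linear_combination -(x + y) * hp))))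
  | @sector₃ x y h =>
    exact Or.inr (Or.inr (Or.inl (h.sector₂.congr rfl (by linear_combination -x * hp))))

theorem FareyVec.orbit_shear_inv_rotate {x y : ℝ} (h : FareyVec x y) :
    FareyOrbit (-y - phi * x) x :=
  Or.inr (Or.inr (Or.inl (h.sector₃.congr rfl (by ring))))

theorem FareyOrbit.shear {x y : ℝ} (h : FareyOrbit x y) : FareyOrbit (x + phi * y) y := by
  rcases h with h | h | h | h
  · exact Or.inl h.sector₀
  · exact FareyOrbit.neg (Or.inl h.sector₀) |>.congr (by ring) (by ring)
  · exact h.orbit_shear_rotate.congr (by ring) rfl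
  · exact h.orbit_shear_rotate.neg.congr (by ring) (by ring)

theorem FareyOrbit.shear_inv {x y : ℝ} (h : FareyOrbit x y) : FareyOrbit (x - phi * y) y := by
  rcases h with h | h | h | h
  · exact h.orbit_shear_inv
  · exact h.orbit_shear_inv.neg.congr (by ring) (by ring)
  · exact h.orbit_shear_inv_rotate.congr (by ring) rfl
  · exact h.orbit_shear_inv_rotate.neg.congr (by ring) (by ring)

theorem FareyOrbit.fareyVec {x y : ℝ} (h : FareyOrbit x y) (hx : 0 < x) (hy : 0 < y) :
    FareyVec x y := by
  rcases h with h | h | h | h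
  · exact h
  all_goals have := h.nonneg; linarith

theorem mact_mul (g h : Matrix (Fin 2) (Fin 2) ℝ) (v : ℝ × ℝ) :
    mact (g * h) v = mact g (mact h v) := by
  ext <;> simp only [mact, Matrix.mul_apply, Fin.sum_univ_two] <;> ring

theorem mact_inv (γ : SL2) (v : ℝ × ℝ) :
    mact ((γ⁻¹ : SL2) : Matrix (Fin 2) (Fin 2) ℝ) v =
      (γ 1 1 * v.1 - γ 0 1 * v.2, γ 0 0 * v.2 - γ 1 0 * v.1) := by
  rw [Matrix.SpecialLinearGroup.coe_inv, Matrix.adjugate_fin_two]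
  ext <;> simp [mact] <;> ring

theorem fareyOrbit_mact {γ : SL2} (hγ : γ ∈ Γ) :
    ∀ v : ℝ × ℝ, FareyOrbit v.1 v.2 →
      FareyOrbit (mact (γ : Matrix (Fin 2) (Fin 2) ℝ) v).1
        (mact (γ : Matrix (Fin 2) (Fin 2) ℝ) v).2 ∧
      FareyOrbit (mact ((γ⁻¹ : SL2) : Matrix (Fin 2) (Fin 2) ℝ) v).1
        (mact ((γ⁻¹ : SL2) : Matrix (Fin 2) (Fin 2) ℝ) v).2 := by
  unfold Γ at hγ
  induction hγ using Subgroup.closure_induction with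
  | mem g hg =>
    intro v hv
    rw [mact_inv]
    rcases hg with rfl | rfl
    · refine ⟨hv.rotate.congr ?_ ?_, hv.rotate.neg.congr ?_ ?_⟩ <;>
        simp [mact, Smat]
    · refine ⟨hv.shear.congr ?_ ?_, hv.shear_inv.congr ?_ ?_⟩ <;>
        simp [mact, Pmat]
  | one => intro v hv; simpa [mact] using hv
  | mul g h _ _ ihg ihh =>
    intro v hv
    rw [_root_.mul_inv_rev, Matrix.SpecialLinearGroup.coe_mul, Matrix.SpecialLinearGroup.coe_mul,
      mact_mul, mact_mul]
    exact ⟨(ihg _ (ihh v hv).1).1, (ihh _ (ihg v hv).2).2⟩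
  | inv g _ ih =>
    intro v hv
    rw [inv_inv]
    exact (ih v hv).symm

theorem fareyOrbit_of_mem_Λ {v : ℝ × ℝ} (hv : v ∈ Λ) : FareyOrbit v.1 v.2 := by
  obtain ⟨γ, hγ, rfl⟩ := hv
  exact (fareyOrbit_mact hγ (1, 0) (Or.inl .e₁)).1

theorem phi_phi_mem_Λ : (phi, phi) ∈ Λ := by
  have hS : Smat ∈ Γ := Subgroup.subset_closure (by simp)
  have hP : Pmat ∈ Γ := Subgroup.subset_closure (by simp)
  refine ⟨Pmat * (Smat * (Pmat * Smat)), mul_mem hP (mul_mem hS (mul_mem hP hS)), ?_⟩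
  simp only [Matrix.SpecialLinearGroup.coe_mul, mact_mul]
  have hp := phi_sq
  ext <;> simp [mact, Pmat, Smat]
  linear_combination -hp

/-- A Farey vector strictly between the directions `(1,0)` and `(1,1)` is mapped outside the strip
of width one. -/
theorem FareyVec.one_lt {x y a b : ℝ} (h : FareyVec x y) (hy : 0 < y) (hyx : y < x) (ha : 0 < a)
    (hab : 0 < a + b) (hb : 1 < a * phi + b) : 1 < a * x + b * y := by
  have h1 := one_lt_phi
  have hp := phi_sq
  cases h with
  | e₁ => exact absurd hy (lt_irrefl _)
  | e₂ => linarith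
  | @sector₀ x y h =>
    have := h.nonneg
    rcases h.eq_zero_or_one_le.2 with h0 | h0
    · linarith
    · nlinarith [mul_nonneg ha.le this.1]
  | @sector₁ x y h =>
    have := h.nonneg
    rcases h.eq_zero_or_one_le.1 with h0 | h0
    · subst h0; linarith
    · have := mul_nonneg (mul_nonneg (by linarith : 0 ≤ phi) this.2) hab.le
      nlinarith
  | @sector₂ x y h => nlinarith [h.nonneg.2]
  | @sector₃ x y h => nlinarith [h.nonneg.1, h.nonneg.2]

/-- On Ω₁, the vector g_{a,b}·(φ,φ) = (φ(a+b), φ/a) is the vector of smallest slope in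
g_{a,b}Λ ∩ ((0,1]×(0,∞)), with slope 1/(a(a+b)). -/
theorem smallest_slope_Omega_one :
    (phi, phi) ∈ Λ ∧
    ∀ a b : ℝ, (a, b) ∈ Ω₁ →
      (mact (gab a b) (phi, phi) = (phi * (a + b), phi / a) ∧
        0 < phi * (a + b) ∧ phi * (a + b) ≤ 1 ∧ 0 < phi / a ∧
        (phi / a) / (phi * (a + b)) = 1 / (a * (a + b))) ∧
      ∀ v ∈ Λ, 0 < (mact (gab a b) v).1 → (mact (gab a b) v).1 ≤ 1 →
        0 < (mact (gab a b) v).2 →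
        1 / (a * (a + b)) ≤ (mact (gab a b) v).2 / (mact (gab a b) v).1 := by
  have h1 := one_lt_phi
  have hp := phi_sq
  refine ⟨phi_phi_mem_Λ, fun a b ⟨⟨ha, ha1, hb, _⟩, _, _, _, hb'⟩ => ?_⟩
  simp only at ha ha1 hb hb'
  rw [phib_eq] at hb'
  have hab : 0 < a + b := by nlinarith
  have hphi : 0 < phi := by linarith
  refine ⟨⟨?_, by positivity, by nlinarith, by positivity, by field_simp⟩, ?_⟩
  · ext <;> simp [mact, gab] <;> ring
  · intro v hv hX hX1 hY
    have hX_eq : (mact (gab a b) v).1 = a * v.1 + b * v.2 := by simp [mact, gab]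
    have hY_eq : (mact (gab a b) v).2 = v.2 / a := by simp [mact, gab]; ring
    rw [hX_eq] at hX hX1 ⊢
    rw [hY_eq] at hY ⊢
    have hy : 0 < v.2 := by simpa [ha] using (div_pos_iff_of_pos_right ha).1 hY
    have hle : v.1 ≤ v.2 := by
      by_contra! hlt
      have := ((fareyOrbit_of_mem_Λ hv).fareyVec (hy.trans hlt) hy).one_lt hy hlt ha hab
        (by linarith)
      linarith
    rw [div_div, div_le_div_iff₀ (by positivity) (by positivity)]
    nlinarith [mul_le_mul_of_nonneg_left hle (mul_pos ha ha).le]
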